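/- (Asymptotic stability of adaptive-complexity MPC.) Assume X^c is a normed real vector space. Let h_t be a terminal control law for terminal set 𝒳_t satisfying the terminal decrease condition V_t(f^c(x', h_t(x'))) − V_t(x') ≤ −L^c(x', h_t(x')) for all x' ∈ 𝒳_t. Assume there is α_ℓ of class K∞ with L^c(x, u) ≥ α_ℓ(‖x‖) for all (x,u) ∈ 𝒵^c. Let X_N be the adaptive feasibility region, assume for every x ∈ X_N an optimal feasible solution of P^a(x) exists (the infimum V*_N(x) is attained), and let h^a(x) denote the first lifted control of such an optimal solution, with closed-loop system x_{k+1} = f^c(x_k, h^a(x_k)). Then: (a) there is α₂ of class K∞ with V*_N(x) ≥ α₂(‖x‖) for all x ∈ X_N; (b) there is α₃ of class K∞ with V*_N(f^c(x, h^a(x))) − V*_N(x) ≤ −α₃(‖x‖) for all x ∈ X_N; and (c) every closed-loop trajectory starting at x_0 ∈ X_N remains in X_N and satisfies ‖x_k‖ → 0 as k → ∞. -/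

import Mathlib

/-- Abstract adaptive-complexity MPC framework: complex system, simple system,
reduction `red` (ψ) with state component `redx` (ψ_x), lift `lift` (ψ†) with state
component `liftx` (ψ†_x), satisfying ψ ∘ ψ† = id. -/
structure ACSys (Xc Uc Xs Us : Type*) where
  fc : Xc × Uc → Xc
  fs : Xs × Us → Xs
  Zc : Set (Xc × Uc)
  Zs : Set (Xs × Us)
  red : Xc × Uc → Xs × Us
  redx : Xc → Xs
  lift : Xs × Us → Xc × Uc
  liftx : Xs → Xc
  redx_spec : ∀ z : Xc × Uc, (red z).1 = redx z.1
  liftx_spec : ∀ z : Xs × Us, (lift z).1 = liftx z.1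
  red_lift : ∀ z : Xs × Us, red (lift z) = z

/-- An adaptive trajectory: complex-space data `(xC i, uC i)` used when `i ∉ S`,
simple-space data `(xS i, uS i)` used when `i ∈ S`. -/
structure ACTraj (Xc Uc Xs Us : Type*) where
  xC : ℕ → Xc
  uC : ℕ → Uc
  xS : ℕ → Xs
  uS : ℕ → Us

variable {Xc Uc Xs Us : Type*}

/-- The lifted state-control pair `z^l_i`. -/
def zl (A : ACSys Xc Uc Xs Us) (S : Finset ℕ) (T : ACTraj Xc Uc Xs Us) (i : ℕ) : Xc × Uc :=
  if i ∈ S then A.lift (T.xS i, T.uS i) else (T.xC i, T.uC i)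

/-- The lifted state `x^l_i`. -/
def xl (A : ACSys Xc Uc Xs Us) (S : Finset ℕ) (T : ACTraj Xc Uc Xs Us) (i : ℕ) : Xc :=
  if i ∈ S then A.liftx (T.xS i) else T.xC i

/-- The lifted control sequence `u^l`. -/
def ul (A : ACSys Xc Uc Xs Us) (S : Finset ℕ) (T : ACTraj Xc Uc Xs Us) : ℕ → Uc :=
  fun i => (zl A S T i).2

/-- The adaptive dynamics: the four cases according to membership of `i`, `i+1` in `S`. -/
def AdaptDyn (A : ACSys Xc Uc Xs Us) (N : ℕ) (S : Finset ℕ) (T : ACTraj Xc Uc Xs Us) : Prop :=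
  ∀ i, i < N →
    (i ∉ S → i + 1 ∉ S → T.xC (i + 1) = A.fc (T.xC i, T.uC i)) ∧
    (i ∉ S → i + 1 ∈ S → T.xS (i + 1) = A.redx (A.fc (T.xC i, T.uC i))) ∧
    (i ∈ S → i + 1 ∉ S → T.xC (i + 1) = A.fc (A.lift (T.xS i, T.uS i))) ∧
    (i ∈ S → i + 1 ∈ S → T.xS (i + 1) = A.fs (T.xS i, T.uS i))

/-- Admissibility of the simplicity set `S` for an adaptive trajectory:
for each `i ∈ S`, (i) `1 ≤ i ≤ N-1`; (ii) `ψ†(ψ(z^l_i)) ∈ 𝒵^c`;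
(iii) `ψ†_x(f^s(ψ(z^l_i))) = f^c(z^l_i)`; (iv) `ψ†_x(ψ_x(f^c(z^l_{i-1}))) = f^c(z^l_{i-1})`. -/
def AdmissibleSet (A : ACSys Xc Uc Xs Us) (N : ℕ) (S : Finset ℕ) (T : ACTraj Xc Uc Xs Us) : Prop :=
  ∀ i ∈ S,
    (1 ≤ i ∧ i < N) ∧
    A.lift (A.red (zl A S T i)) ∈ A.Zc ∧
    A.liftx (A.fs (A.red (zl A S T i))) = A.fc (zl A S T i) ∧
    A.liftx (A.redx (A.fc (zl A S T (i - 1)))) = A.fc (zl A S T (i - 1))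

/-- The solution map φ of the complex system: `φ 0 x u = x`, `φ (i+1) x u = f^c(φ i x u, u i)`. -/
def Phi (A : ACSys Xc Uc Xs Us) : ℕ → Xc → (ℕ → Uc) → Xc
  | 0, x, _ => x
  | i + 1, x, u => A.fc (Phi A i x u, u i)

/-- Feasibility of an adaptive trajectory for the adaptive OCP `P^a(x)` with horizon `N`
and terminal set `Xt`. -/
def FeasAdapt (A : ACSys Xc Uc Xs Us) (N : ℕ) (S : Finset ℕ) (T : ACTraj Xc Uc Xs Us)
    (Xt : Set Xc) (x : Xc) : Prop :=
  T.xC 0 = x ∧ (∀ i ∈ S, (T.xS i, T.uS i) ∈ A.Zs) ∧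
    (∀ i, i < N → i ∉ S → (T.xC i, T.uC i) ∈ A.Zc) ∧ T.xC N ∈ Xt

/-- A terminal control law for terminal set `Xt`. -/
def TermLaw (A : ACSys Xc Uc Xs Us) (Xt : Set Xc) (ht : Xc → Uc) : Prop :=
  ∀ x ∈ Xt, (x, ht x) ∈ A.Zc ∧ A.fc (x, ht x) ∈ Xt

/-- Feasibility of a control sequence for the complex OCP `P(x)` with horizon `N`. -/
def FeasComplex (A : ACSys Xc Uc Xs Us) (N : ℕ) (Xt : Set Xc) (x : Xc) (u : ℕ → Uc) : Prop :=
  (∀ i, i < N → (Phi A i x u, u i) ∈ A.Zc) ∧ Phi A N x u ∈ Xt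

/-- The adaptive feasibility region `X_N`. -/
def XNreg (A : ACSys Xc Uc Xs Us) (N : ℕ) (Xt : Set Xc) : Set Xc :=
  {x | ∃ (S : Finset ℕ) (T : ACTraj Xc Uc Xs Us),
    AdmissibleSet A N S T ∧ AdaptDyn A N S T ∧ FeasAdapt A N S T Xt x}

/-- The set of states admitting a feasible complex OCP solution with horizon `N`. -/
def XcplxSet (A : ACSys Xc Uc Xs Us) (N : ℕ) (Xt : Set Xc) : Set Xc :=
  {x | ∃ u : ℕ → Uc, FeasComplex A N Xt x u}

/-- The cost of an adaptive trajectory: `Σ_{i<N} L^c(z^l_i) + V_t(x^l_N)`. -/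
noncomputable def trajCost (A : ACSys Xc Uc Xs Us) (N : ℕ) (S : Finset ℕ)
    (T : ACTraj Xc Uc Xs Us) (Lc : Xc × Uc → ℝ) (Vt : Xc → ℝ) : ℝ :=
  (∑ i ∈ Finset.range N, Lc (zl A S T i)) + Vt (xl A S T N)

/-- The optimal value `V*_N(x)`: infimum of costs over admissible simplicity sets and
feasible adaptive trajectories for `P^a(x)`. -/
noncomputable def Vstar (A : ACSys Xc Uc Xs Us) (N : ℕ) (Xt : Set Xc)
    (Lc : Xc × Uc → ℝ) (Vt : Xc → ℝ) (x : Xc) : ℝ :=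
  sInf {c | ∃ (S : Finset ℕ) (T : ACTraj Xc Uc Xs Us),
    AdmissibleSet A N S T ∧ AdaptDyn A N S T ∧ FeasAdapt A N S T Xt x ∧
    c = trajCost A N S T Lc Vt}

/-- A function `[0,∞) → [0,∞)` of class `K∞`: continuous, strictly increasing, `α 0 = 0`,
and `α r → ∞` as `r → ∞`. -/
def ClassKInf (α : ℝ → ℝ) : Prop :=
  ContinuousOn α (Set.Ici 0) ∧ StrictMonoOn α (Set.Ici 0) ∧ α 0 = 0 ∧
    (∀ r, 0 ≤ r → 0 ≤ α r) ∧ Filter.Tendsto α Filter.atTop Filter.atTop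

theorem zl_fst_aux (A : ACSys Xc Uc Xs Us) (S : Finset ℕ) (T : ACTraj Xc Uc Xs Us) (i : ℕ) :
    (zl A S T i).1 = xl A S T i := by
  unfold zl xl
  split_ifs
  · exact A.liftx_spec _
  · rfl

theorem zl_mem_aux (A : ACSys Xc Uc Xs Us) (N : ℕ) (S : Finset ℕ) (T : ACTraj Xc Uc Xs Us)
    (Xt : Set Xc) (x : Xc) (h1 : AdmissibleSet A N S T) (h3 : FeasAdapt A N S T Xt x)
    (i : ℕ) (hi : i < N) : zl A S T i ∈ A.Zc := by
  by_cases h : i ∈ S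
  · have := (h1 i h).2.1
    simp only [zl, if_pos h, A.red_lift] at this ⊢
    exact this
  · have := h3.2.2.1 i hi h
    simp only [zl, if_neg h]
    exact this

theorem xl_succ_aux (A : ACSys Xc Uc Xs Us) (N : ℕ) (S : Finset ℕ) (T : ACTraj Xc Uc Xs Us)
    (h1 : AdmissibleSet A N S T) (h2 : AdaptDyn A N S T)
    (i : ℕ) (hi : i < N) : xl A S T (i + 1) = A.fc (zl A S T i) := by
  obtain ⟨d1, d2, d3, d4⟩ := h2 i hi
  by_cases h : i ∈ S <;> by_cases h' : i + 1 ∈ S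
  · have := (h1 i h).2.2.1
    simp only [zl, xl, if_pos h, if_pos h', A.red_lift] at this ⊢
    rw [d4 h h', this]
  · simp only [zl, xl, if_pos h, if_neg h']
    exact d3 h h'
  · have := (h1 (i+1) h').2.2.2
    simp only [Nat.add_sub_cancel, zl, xl, if_neg h, if_pos h'] at this ⊢
    rw [d2 h h', this]
  · simp only [zl, xl, if_neg h, if_neg h']
    exact d1 h h'

theorem Vstar_le_aux (A : ACSys Xc Uc Xs Us) (N : ℕ) (Xt : Set Xc)
    (Lc : Xc × Uc → ℝ) (Vt : Xc → ℝ)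
    (hLc : ∀ z : Xc × Uc, 0 ≤ Lc z) (hVt : ∀ y : Xc, 0 ≤ Vt y)
    (S : Finset ℕ) (T : ACTraj Xc Uc Xs Us) (x : Xc)
    (h1 : AdmissibleSet A N S T) (h2 : AdaptDyn A N S T) (h3 : FeasAdapt A N S T Xt x) :
    Vstar A N Xt Lc Vt x ≤ trajCost A N S T Lc Vt := by
  apply csInf_le
  · refine ⟨0, ?_⟩
    rintro c ⟨S, T, -, -, -, rfl⟩
    exact add_nonneg (Finset.sum_nonneg fun i _ => hLc _) (hVt _)
  · exact ⟨S, T, h1, h2, h3, rfl⟩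

theorem step_aux (A : ACSys Xc Uc Xs Us) (N : ℕ) (hN : 1 ≤ N) (Xt : Set Xc) (ht : Xc → Uc)
    (hht : TermLaw A Xt ht)
    (Lc : Xc × Uc → ℝ) (Vt : Xc → ℝ)
    (hdec : ∀ y ∈ Xt, Vt (A.fc (y, ht y)) - Vt y ≤ - Lc (y, ht y))
    (S : Finset ℕ) (T : ACTraj Xc Uc Xs Us) (x : Xc)
    (h1 : AdmissibleSet A N S T) (h2 : AdaptDyn A N S T) (h3 : FeasAdapt A N S T Xt x) :
    ∃ (T' : ACTraj Xc Uc Xs Us), AdmissibleSet A N ∅ T' ∧ AdaptDyn A N ∅ T' ∧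
      FeasAdapt A N ∅ T' Xt (A.fc (zl A S T 0)) ∧
      trajCost A N ∅ T' Lc Vt ≤ trajCost A N S T Lc Vt - Lc (zl A S T 0) := by
  obtain ⟨M, rfl⟩ : ∃ M, N = M + 1 := ⟨N - 1, by omega⟩
  have hNS : M + 1 ∉ S := fun h => by have := (h1 _ h).1.2; omega
  have hxt : xl A S T (M + 1) ∈ Xt := by
    simp only [xl, if_neg hNS]; exact h3.2.2.2
  have hd := xl_succ_aux A _ S T h1 h2
  have hz := zl_mem_aux A _ S T Xt x h1 h3
  have hf := zl_fst_aux A S T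
  let y := xl A S T (M + 1)
  let xC' : ℕ → Xc := fun i => if i ≤ M then xl A S T (i + 1) else A.fc (y, ht y)
  let uC' : ℕ → Uc := fun i => if i < M then (zl A S T (i + 1)).2 else ht y
  have e1 : ∀ i, i < M → (xC' i, uC' i) = zl A S T (i + 1) := by
    intro i hi
    simp only [xC', uC', if_pos hi, if_pos hi.le]
    rw [← hf]
  have e2 : (xC' M, uC' M) = (y, ht y) := by simp [xC', uC', y]
  have e3 : xC' (M + 1) = A.fc (y, ht y) := by simp [xC']
  refine ⟨⟨xC', uC', T.xS, T.uS⟩, ?_, ?_, ⟨?_, ?_, ?_, ?_⟩, ?_⟩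
  · intro i hi; simp at hi
  · intro i hi
    refine ⟨fun _ _ => ?_, fun _ h => by simp at h, fun h => by simp at h, fun h => by simp at h⟩
    change xC' (i + 1) = A.fc (xC' i, uC' i)
    rcases Nat.lt_or_ge i M with h | h
    · rw [e1 i h, ← hd _ (by omega)]
      simp only [xC']
      rw [if_pos (by omega)]
    · obtain rfl : i = M := by omega
      rw [e2, e3]
  · change xC' 0 = _
    rw [← hd 0 (by omega)]
    simp [xC']
  · intro i hi; simp at hi
  · intro i hi _
    change (xC' i, uC' i) ∈ _
    rcases Nat.lt_or_ge i M with h | h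
    · rw [e1 i h]; exact hz _ (by omega)
    · obtain rfl : i = M := by omega
      rw [e2]; exact (hht _ hxt).1
  · change xC' (M + 1) ∈ Xt
    rw [e3]; exact (hht _ hxt).2
  · have hzz : ∀ i, zl A ∅ (⟨xC', uC', T.xS, T.uS⟩ : ACTraj Xc Uc Xs Us) i = (xC' i, uC' i) := by
      intro i; simp [zl]
    have hxx : xl A ∅ (⟨xC', uC', T.xS, T.uS⟩ : ACTraj Xc Uc Xs Us) (M + 1) = A.fc (y, ht y) := by
      rw [← e3]; simp [xl]
    unfold trajCost
    rw [hxx, Finset.sum_range_succ, Finset.sum_range_succ', hzz M, e2]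
    have : ∑ i ∈ Finset.range M, Lc (zl A ∅ (⟨xC', uC', T.xS, T.uS⟩ : ACTraj Xc Uc Xs Us) i)
        = ∑ i ∈ Finset.range M, Lc (zl A S T (i + 1)) := by
      apply Finset.sum_congr rfl
      intro i hi
      rw [hzz, e1 i (Finset.mem_range.mp hi)]
    rw [this]
    have := hdec y hxt
    change _ ≤ _ + Vt y - _
    linarith

/-- asymptotic stability of adaptive-complexity MPC: (a) the optimal value is
lower bounded by a class-`K∞` function of the norm; (b) it strictly decreases along the closed
loop by a class-`K∞` amount; (c) closed-loop trajectories starting in `X_N` stay in `X_N` and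
converge to the origin. -/
theorem adaptive_complexity_mpc_asymptotic_stability
    [NormedAddCommGroup Xc] [NormedSpace ℝ Xc]
    (A : ACSys Xc Uc Xs Us) (N : ℕ) (hN : 1 ≤ N) (Xt : Set Xc) (ht : Xc → Uc)
    (hht : TermLaw A Xt ht)
    (Lc : Xc × Uc → ℝ) (Vt : Xc → ℝ)
    (hLc : ∀ z : Xc × Uc, 0 ≤ Lc z) (hVt : ∀ y : Xc, 0 ≤ Vt y)
    (hdec : ∀ y ∈ Xt, Vt (A.fc (y, ht y)) - Vt y ≤ - Lc (y, ht y))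
    (αl : ℝ → ℝ) (hαl : ClassKInf αl)
    (hlb : ∀ z ∈ A.Zc, αl ‖z.1‖ ≤ Lc z)
    (ha : Xc → Uc)
    (hopt : ∀ x ∈ XNreg A N Xt, ∃ (S : Finset ℕ) (T : ACTraj Xc Uc Xs Us),
      AdmissibleSet A N S T ∧ AdaptDyn A N S T ∧ FeasAdapt A N S T Xt x ∧
      trajCost A N S T Lc Vt = Vstar A N Xt Lc Vt x ∧ ul A S T 0 = ha x) :
    (∃ α2 : ℝ → ℝ, ClassKInf α2 ∧
      ∀ x ∈ XNreg A N Xt, α2 ‖x‖ ≤ Vstar A N Xt Lc Vt x) ∧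
    (∃ α3 : ℝ → ℝ, ClassKInf α3 ∧
      ∀ x ∈ XNreg A N Xt,
        Vstar A N Xt Lc Vt (A.fc (x, ha x)) - Vstar A N Xt Lc Vt x ≤ - α3 ‖x‖) ∧
    (∀ x0 ∈ XNreg A N Xt, ∀ xs : ℕ → Xc, xs 0 = x0 →
      (∀ k, xs (k + 1) = A.fc (xs k, ha (xs k))) →
      (∀ k, xs k ∈ XNreg A N Xt) ∧
      Filter.Tendsto (fun k => ‖xs k‖) Filter.atTop (nhds 0)) := by
  have key : ∀ x ∈ XNreg A N Xt, A.fc (x, ha x) ∈ XNreg A N Xt ∧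
      αl ‖x‖ ≤ Vstar A N Xt Lc Vt x ∧
      Vstar A N Xt Lc Vt (A.fc (x, ha x)) - Vstar A N Xt Lc Vt x ≤ - αl ‖x‖ := by
    intro x hx
    obtain ⟨S, T, h1, h2, h3, h4, h5⟩ := hopt x hx
    have h0 : 0 ∉ S := fun h => by have := (h1 _ h).1.1; omega
    have hz0 : zl A S T 0 = (x, ha x) := by
      rw [← h5, ← h3.1]
      simp [ul, zl, h0]
    have hL : αl ‖x‖ ≤ Lc (zl A S T 0) := by
      have := hlb _ (zl_mem_aux A N S T Xt x h1 h3 0 (by omega))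
      rwa [hz0] at this ⊢
    obtain ⟨T', g1, g2, g3, g4⟩ := step_aux A N hN Xt ht hht Lc Vt hdec S T x h1 h2 h3
    have g5 := Vstar_le_aux A N Xt Lc Vt hLc hVt ∅ T' _ g1 g2 g3
    have g6 : 0 ≤ trajCost A N ∅ T' Lc Vt :=
      add_nonneg (Finset.sum_nonneg fun i _ => hLc _) (hVt _)
    rw [hz0] at g3 g4 g5 hL
    exact ⟨⟨∅, T', g1, g2, g3⟩, by linarith, by linarith⟩
  refine ⟨⟨αl, hαl, fun x hx => (key x hx).2.1⟩, ⟨αl, hαl, fun x hx => (key x hx).2.2⟩, ?_⟩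
  intro x0 hx0 xs hxs0 hxs
  have hmem : ∀ k, xs k ∈ XNreg A N Xt := by
    intro k
    induction k with
    | zero => rw [hxs0]; exact hx0
    | succ k ih => rw [hxs]; exact (key _ ih).1
  refine ⟨hmem, ?_⟩
  obtain ⟨-, hmono, hz, hnn, -⟩ := hαl
  have hsum : ∀ n, ∑ k ∈ Finset.range n, αl ‖xs k‖
      ≤ Vstar A N Xt Lc Vt (xs 0) - Vstar A N Xt Lc Vt (xs n) := by
    intro n
    induction n with
    | zero => simp
    | succ n ih =>
      rw [Finset.sum_range_succ]
      have := (key _ (hmem n)).2.2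
      rw [← hxs] at this
      linarith
  have hs : Summable (fun k => αl ‖xs k‖) := by
    refine summable_of_sum_range_le (c := Vstar A N Xt Lc Vt (xs 0))
      (fun k => hnn _ (norm_nonneg _)) (fun n => ?_)
    have h1 := (key _ (hmem n)).2.1
    have h2 := hnn _ (norm_nonneg (xs n))
    linarith [hsum n]
  have hlim := hs.tendsto_atTop_zero
  rw [Metric.tendsto_atTop]
  intro ε hε
  have hpos : 0 < αl ε := by
    rw [← hz]
    exact hmono (Set.mem_Ici.mpr le_rfl) (Set.mem_Ici.mpr hε.le) hε
  obtain ⟨n0, hn0⟩ := Filter.eventually_atTop.mp (hlim.eventually (gt_mem_nhds hpos))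
  refine ⟨n0, fun n hn => ?_⟩
  rw [Real.dist_eq, sub_zero, abs_of_nonneg (norm_nonneg _)]
  exact (hmono.lt_iff_lt (Set.mem_Ici.mpr (norm_nonneg _)) (Set.mem_Ici.mpr hε.le)).mp (hn0 n hn)
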